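/- Let R be a NAND-free k-ary Boolean relation and let C_1 and C_2 be two positive flip sets that are valid at s ∈ R. Then C_1 ∪ C_2 is also a valid flip set at s. -/

import Mathlib

def IsRestriction {k k' : ℕ} (R : Set (Fin k → Bool)) (R' : Set (Fin k' → Bool)) : Prop :=
  k' ≤ k ∧ ∃ X : Fin k → (Fin k' ⊕ Bool),
    ∀ r : Fin k' → Bool, r ∈ R' ↔ (fun i => Sum.elim r id (X i)) ∈ R

/-- The NAND relation `{01, 10, 00}`. -/
def nandRel : Set (Fin 2 → Bool) := {r | ¬(r 0 = true ∧ r 1 = true)}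

/-- The OR relation `{01, 10, 11}`. -/
def orRel : Set (Fin 2 → Bool) := {r | r 0 = true ∨ r 1 = true}

/-- The dual-Horn-clause relation `{0,1}^3 \ {100}`. -/
def dualHornRel : Set (Fin 3 → Bool) := {r | ¬(r 0 = true ∧ r 1 = false ∧ r 2 = false)}

/-- `R` is NAND-free if no restriction of `R` equals the NAND relation `{01,10,00}`. -/
def NANDFree {k : ℕ} (R : Set (Fin k → Bool)) : Prop := ¬ IsRestriction R nandRel

/-- `R` is OR-free if no restriction of `R` equals the OR relation `{01,10,11}`. -/
def ORFree {k : ℕ} (R : Set (Fin k → Bool)) : Prop := ¬ IsRestriction R orRel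

/-- `R` is dual-Horn-free if no restriction of `R` equals `{0,1}^3 \ {100}`. -/
def DualHornFree {k : ℕ} (R : Set (Fin k → Bool)) : Prop := ¬ IsRestriction R dualHornRel

/-- A flip is a variable together with the value it flips *to*:
`(i, true)` is the positive flip `xᵢ⁺` (0→1), `(i, false)` the negative flip `xᵢ⁻` (1→0). -/
abbrev Flip (α : Type) := α × Bool

/-- Apply a flip to an assignment. -/
def applyFlip {α : Type} [DecidableEq α] (a : α → Bool) (f : Flip α) : α → Bool :=
  Function.update a f.1 f.2

/-- Apply a flip sequence (left to right) to an assignment; `applySeq s F` is `F(s)`. -/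
def applySeq {α : Type} [DecidableEq α] (s : α → Bool) (F : List (Flip α)) : α → Bool :=
  F.foldl applyFlip s

/-- `ValidSeq R s F`: the flip sequence `F` is valid at `s` with respect to `R`, i.e.
each flip in turn is applicable and every intermediate assignment (including `s` and
the final one) lies in `R`. -/
def ValidSeq {α : Type} [DecidableEq α] (R : Set (α → Bool)) :
    (α → Bool) → List (Flip α) → Prop
  | s, [] => s ∈ R
  | s, f :: F => s ∈ R ∧ s f.1 = !f.2 ∧ ValidSeq R (applyFlip s f) F

/-- A set of flips is a *valid flip set* at `s` if its elements can be arranged into a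
flip sequence valid at `s`. -/
def ValidFlipSet {α : Type} [DecidableEq α] (R : Set (α → Bool)) (s : α → Bool)
    (C : Finset (Flip α)) : Prop :=
  ∃ F : List (Flip α), F.Nodup ∧ F.toFinset = C ∧ ValidSeq R s F

/-- A NAND-free relation that contains `a` and two positive single-bit flips of `a` also contains
the assignment with both bits flipped. -/
theorem NANDFree.update_update_mem {k : ℕ} {R : Set (Fin k → Bool)} (hR : NANDFree R)
    {a : Fin k → Bool} {i j : Fin k} (hij : i ≠ j) (hi : a i = false) (hj : a j = false)
    (ha : a ∈ R) (hai : Function.update a i true ∈ R) (haj : Function.update a j true ∈ R) :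
    Function.update (Function.update a i true) j true ∈ R := by
  by_contra hn
  refine hR ⟨?_, fun m => if m = i then .inl 0 else if m = j then .inl 1 else .inr (a m), ?_⟩
  · have := Fin.val_ne_of_ne hij
    omega
  · intro r
    have key : (fun m => Sum.elim r id
        (if m = i then .inl 0 else if m = j then .inl 1 else .inr (a m))) =
        Function.update (Function.update a i (r 0)) j (r 1) := by
      funext m
      by_cases h1 : m = i
      · subst h1
        simp [hij]
      · by_cases h2 : m = j <;> simp [h1, h2, hij.symm]
    rw [key]
    have hi' : Function.update a i false = a := by rw [← hi, Function.update_eq_self]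
    have hj' : Function.update a j false = a := by rw [← hj, Function.update_eq_self]
    have hij' : Function.update (Function.update a i true) j false = Function.update a i true := by
      rw [Function.update_comm hij, hj']
    cases h0 : r 0 <;> cases h1 : r 1 <;> simp [nandRel, *]

theorem ValidSeq.mem {α : Type} [DecidableEq α] {R : Set (α → Bool)} {s : α → Bool}
    {F : List (Flip α)} (h : ValidSeq R s F) : s ∈ R := by
  cases F with
  | nil => exact h
  | cons f F => exact h.1

/-- Performing an applicable positive flip `f` first leaves the rest of a positive valid flip
sequence valid. -/
theorem ValidSeq.erase_applyFlip {k : ℕ} {R : Set (Fin k → Bool)} (hR : NANDFree R)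
    {f : Flip (Fin k)} (hf : f.2 = true) {F : List (Flip (Fin k))} {s : Fin k → Bool}
    (hs : s f.1 = false) (hmem : applyFlip s f ∈ R) (hpos : ∀ g ∈ F, g.2 = true)
    (hF : ValidSeq R s F) : ValidSeq R (applyFlip s f) (F.erase f) := by
  induction F generalizing s with
  | nil => exact hmem
  | cons g F ih =>
    obtain ⟨hsR, hsg, hF⟩ := hF
    by_cases hgf : g = f
    · subst hgf
      simpa using hF
    · have hg : g.2 = true := hpos g (by simp)
      have hne : f.1 ≠ g.1 := fun h => hgf (Prod.ext h.symm (hg.trans hf.symm))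
      have hsg' : s g.1 = false := by simpa [hg] using hsg
      have hcomm : applyFlip (applyFlip s g) f = applyFlip (applyFlip s f) g :=
        Function.update_comm hne.symm _ _ _
      have hboth : applyFlip (applyFlip s f) g ∈ R := by
        have hgR := hF.mem
        simp only [applyFlip, hf, hg] at hmem hgR ⊢
        exact hR.update_update_mem hne hs hsg' hsR hmem hgR
      rw [List.erase_cons_tail (by simpa using hgf)]
      refine ⟨hmem, ?_, ?_⟩
      · simpa [applyFlip, Function.update_of_ne hne.symm] using hsg
      · rw [← hcomm]
        refine ih ?_ (hcomm ▸ hboth) (fun x hx => hpos x (by simp [hx])) hF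
        simpa [applyFlip, Function.update_of_ne hne] using hs

theorem ValidSeq.exists_union {k : ℕ} {R : Set (Fin k → Bool)} (hR : NANDFree R)
    {F G : List (Flip (Fin k))} {s : Fin k → Bool}
    (hFpos : ∀ f ∈ F, f.2 = true) (hGpos : ∀ f ∈ G, f.2 = true)
    (hFn : F.Nodup) (hGn : G.Nodup) (hF : ValidSeq R s F) (hG : ValidSeq R s G) :
    ValidFlipSet R s (F.toFinset ∪ G.toFinset) := by
  induction F generalizing s G with
  | nil => exact ⟨G, hGn, by simp, hG⟩
  | cons f F ih =>
    obtain ⟨hsR, hsf, hF⟩ := hF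
    have hf : f.2 = true := hFpos f (by simp)
    obtain ⟨hfF, hFn⟩ := List.nodup_cons.1 hFn
    obtain ⟨H, hHn, hH, hHv⟩ := ih (fun x hx => hFpos x (by simp [hx]))
      (fun x hx => hGpos x (List.mem_of_mem_erase hx)) hFn (hGn.erase f) hF
      (hG.erase_applyFlip hR hf (by simpa [hf] using hsf) hF.mem hGpos)
    have hmem (x) : x ∈ H ↔ x ∈ F ∨ x ≠ f ∧ x ∈ G := by
      rw [← List.mem_toFinset, hH]
      simp [hGn.mem_erase_iff]
    refine ⟨f :: H, List.nodup_cons.2 ⟨by simp [hmem, hfF], hHn⟩, ?_, hsR, hsf, hHv⟩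
    ext x
    simp only [List.mem_toFinset, List.mem_cons, Finset.mem_union, hmem]
    tauto

/-- Lemma 3: for `R` a NAND-free relation, the union of two positive flip sets valid
at `s ∈ R` is a valid flip set at `s`. -/
theorem union_validFlipSet {k : ℕ} (R : Set (Fin k → Bool)) (hR : NANDFree R)
    (s : Fin k → Bool) (hs : s ∈ R) (C1 C2 : Finset (Flip (Fin k)))
    (hpos1 : ∀ f ∈ C1, f.2 = true) (hpos2 : ∀ f ∈ C2, f.2 = true)
    (h1 : ValidFlipSet R s C1) (h2 : ValidFlipSet R s C2) :
    ValidFlipSet R s (C1 ∪ C2) := by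
  obtain ⟨F, hFn, rfl, hF⟩ := h1
  obtain ⟨G, hGn, rfl, hG⟩ := h2
  exact ValidSeq.exists_union hR (fun f hf => hpos1 f (List.mem_toFinset.2 hf))
    (fun f hf => hpos2 f (List.mem_toFinset.2 hf)) hFn hGn hF hG
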